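/- For every integer g with g > 101, the images of a₁a₂′⁴, a₁c₂², a₂′⁵, and a₂′c₂² in S(g) form a ℚ-basis of the weighted-degree-5 component S(g)_5; in particular dim_ℚ S(g)_5 = 4. -/

import Mathlib

open MvPolynomial

noncomputable section

/-- The polynomial ring `ℚ[a₁, a₂′, a₂, c₂]`. -/
abbrev P4 : Type := MvPolynomial (Fin 4) ℚ

/-- Weights: `a₁` and `a₂′` have weight 1; `a₂` and `c₂` have weight 2. -/
def wt : Fin 4 → ℕ := ![1, 1, 2, 2]

def a1 : P4 := X 0
def a2' : P4 := X 1
def a2 : P4 := X 2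
def c2 : P4 := X 3

/-- The relation `r₁`. -/
def r1 (g : ℤ) : P4 :=
  C (1064*(g:ℚ) + 3610) * a1^3 - C (1074 : ℚ) * (a1^2 * a2')
    - C (2148*(g:ℚ) + 7272) * (a1 * a2) + C (2160 : ℚ) * (a2 * a2')
    - C (1064*(g:ℚ)^3 + 10830*(g:ℚ)^2 + 36680*(g:ℚ) + 41360) * (a1 * c2)
    + C (1074*(g:ℚ)^2 + 7272*(g:ℚ) + 12288) * (a2' * c2)

/-- The relation `r₂`. -/
def r2 (g : ℤ) : P4 :=
  - C (6412*(g:ℚ) + 21255) * a1^3 + C (6207 : ℚ) * (a1^2 * a2')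
    + C (12414*(g:ℚ) + 40896) * (a1 * a2) - C (11880 : ℚ) * (a2 * a2')
    + C (6412*(g:ℚ)^3 + 63765*(g:ℚ)^2 + 211540*(g:ℚ) + 234480) * (a1 * c2)
    - C (6207*(g:ℚ)^2 + 40896*(g:ℚ) + 68184) * (a2' * c2)

/-- The relation `r₃`. -/
def r3 (g : ℤ) : P4 :=
  - C (22845*(g:ℚ) + 67763) * a1^4 + C (18141 : ℚ) * (a1^3 * a2')
    + C (54423*(g:ℚ) + 146550) * (a1^2 * a2) - C (35640 : ℚ) * (a1 * a2 * a2')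
    + C (45690*(g:ℚ)^3 + 406578*(g:ℚ)^2 + 1184220*(g:ℚ) + 1123060) * (a1^2 * c2)
    - C (54423*(g:ℚ)^2 + 293100*(g:ℚ) + 372648) * (a1 * a2' * c2)
    + C (17820*(g:ℚ) + 24840) * (a2'^2 * c2)
    - C (17820*(g:ℚ) + 24840) * (a2^2)
    - C (18141*(g:ℚ)^3 + 146550*(g:ℚ)^2 + 372648*(g:ℚ) + 283824) * (a2 * c2)
    - C (4569*(g:ℚ)^5 + 67763*(g:ℚ)^4 + 394740*(g:ℚ)^3 + 1123060*(g:ℚ)^2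
        + 1546176*(g:ℚ) + 810432) * (c2^2)

/-- The relation `r₄`. -/
def r4 (g : ℤ) : P4 :=
  C (133 : ℚ) * a1^4 - C (537 : ℚ) * (a1^2 * a2)
    - C (798*(g:ℚ)^2 + 5415*(g:ℚ) + 9170) * (a1^2 * c2)
    + C (1074*(g:ℚ) + 3636) * (a1 * a2' * c2)
    - C (540 : ℚ) * (a2'^2 * c2) + C (540 : ℚ) * (a2^2)
    + C (537*(g:ℚ)^2 + 3636*(g:ℚ) + 6144) * (a2 * c2)
    + C (133*(g:ℚ)^4 + 1805*(g:ℚ)^3 + 9170*(g:ℚ)^2 + 20680*(g:ℚ) + 17472) * (c2^2)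

/-- The relation `r₅`. -/
def r5 (g : ℤ) : P4 :=
  - C (18545*(g:ℚ) + 68407) * a1^4 + C (15261 : ℚ) * (a1^3 * a2')
    + C (45783*(g:ℚ) + 175866) * (a1^2 * a2) - C (31320 : ℚ) * (a1 * a2 * a2')
    + C (37090*(g:ℚ)^3 + 410442*(g:ℚ)^2 + 1499460*(g:ℚ) + 1811300) * (a1^2 * c2)
    - C (45783*(g:ℚ)^2 + 351732*(g:ℚ) + 662976) * (a1 * a2' * c2)
    + C (15660*(g:ℚ) + 72360) * (a2'^2 * c2)
    - C (15660*(g:ℚ) + 72360) * (a2^2)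
    - C (15261*(g:ℚ)^3 + 175866*(g:ℚ)^2 + 662976*(g:ℚ) + 822096) * (a2 * c2)
    - C (3709*(g:ℚ)^5 + 68407*(g:ℚ)^4 + 499820*(g:ℚ)^3 + 1811300*(g:ℚ)^2
        + 3260256*(g:ℚ) + 2334528) * (c2^2)

/-- The ideal `J(g) = (r₁, r₂, r₃, r₄, r₅)`. -/
def Jg (g : ℤ) : Ideal P4 := Ideal.span {r1 g, r2 g, r3 g, r4 g, r5 g}

/-- The quotient map `P → S(g) = P/J(g)`, as a `ℚ`-linear map. -/
def Smk (g : ℤ) : P4 →ₗ[ℚ] P4 ⧸ Jg g := (Ideal.Quotient.mkₐ ℚ (Jg g)).toLinearMap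

/-- `S(g)_i`: the image in `S(g)` of the weighted-degree-`i` homogeneous polynomials. -/
def SComp (g : ℤ) (i : ℕ) : Submodule ℚ (P4 ⧸ Jg g) :=
  (weightedHomogeneousSubmodule ℚ wt i).map (Smk g)

/-- The monomial `a₁ᵃ a₂′ᵇ a₂ʸ c₂ᶜ`. -/
def mon (a b y c : ℕ) : P4 := monomial (Finsupp.equivFunOnFinite.symm ![a, b, y, c]) 1

theorem mon_eq (a b y c : ℕ) : mon a b y c = a1^a * a2'^b * a2^y * c2^c := by
  rw [mon, monomial_eq, Finsupp.prod_fintype _ _ (by simp)]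
  simp [Fin.prod_univ_four, a1, a2', a2, c2]

theorem mon_mul_mon (a b y c a' b' y' c' : ℕ) :
    mon a b y c * mon a' b' y' c' = mon (a + a') (b + b') (y + y') (c + c') := by
  simp only [mon_eq]
  ring

theorem weight_wt (d : Fin 4 →₀ ℕ) :
    Finsupp.weight wt d = d 0 + d 1 + 2 * d 2 + 2 * d 3 := by
  rw [Finsupp.weight_apply, Finsupp.sum_fintype _ _ (by simp)]
  simp [Fin.sum_univ_four, wt]
  ring

theorem mon_mem {a b y c n : ℕ} (h : a + b + 2*y + 2*c = n) :
    mon a b y c ∈ weightedHomogeneousSubmodule ℚ wt n :=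
  isWeightedHomogeneous_monomial _ _ _ (by simpa [weight_wt] using h)

theorem monomial_eq_smul_mon (d : Fin 4 →₀ ℕ) (q : ℚ) :
    monomial d q = q • mon (d 0) (d 1) (d 2) (d 3) := by
  have : Finsupp.equivFunOnFinite.symm ![d 0, d 1, d 2, d 3] = d := by
    ext i
    fin_cases i <;> rfl
  rw [mon, this, smul_monomial, smul_eq_mul, mul_one]

/-- A submodule containing all monomials of weight `n` contains every weighted-homogeneous
polynomial of degree `n`. -/
theorem weightedHomogeneousSubmodule_le {n : ℕ} {W : Submodule ℚ P4}
    (hW : ∀ a b y c, a + b + 2*y + 2*c = n → mon a b y c ∈ W) :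
    weightedHomogeneousSubmodule ℚ wt n ≤ W := by
  intro p hp
  rw [p.as_sum]
  refine W.sum_mem fun d hd => ?_
  rw [monomial_eq_smul_mon]
  refine W.smul_mem _ (hW _ _ _ _ ?_)
  rw [← weight_wt]
  exact hp (mem_support_iff.mp hd)

/-- The exponents `(a, b, y, c)` of the monomials `a₁ᵃ a₂′ᵇ a₂ʸ c₂ᶜ` of weight `n`. -/
def exponents (n : ℕ) : Finset (ℕ × ℕ × ℕ × ℕ) :=
  (Finset.range (n + 1) ×ˢ Finset.range (n + 1) ×ˢ Finset.range (n / 2 + 1) ×ˢ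
    Finset.range (n / 2 + 1)).filter fun t => t.1 + t.2.1 + 2*t.2.2.1 + 2*t.2.2.2 = n

theorem mem_exponents {n a b y c : ℕ} :
    (a, b, y, c) ∈ exponents n ↔ a + b + 2*y + 2*c = n := by
  simp only [exponents, Finset.mem_filter, Finset.mem_product, Finset.mem_range]
  omega

theorem card_exponents_one : (exponents 1).card = 2 := by decide

theorem card_exponents_two : (exponents 2).card = 5 := by decide

theorem card_exponents_five : (exponents 5).card = 20 := by decide +kernel

theorem weightedHomogeneousSubmodule_eq_span (n : ℕ) :
    weightedHomogeneousSubmodule ℚ wt n =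
      Submodule.span ℚ (Set.range fun t : exponents n => mon t.1.1 t.1.2.1 t.1.2.2.1 t.1.2.2.2) := by
  refine le_antisymm (weightedHomogeneousSubmodule_le fun a b y c h => ?_)
    (Submodule.span_le.mpr ?_)
  · exact Submodule.subset_span ⟨⟨(a, b, y, c), mem_exponents.mpr h⟩, rfl⟩
  · rintro _ ⟨⟨⟨a, b, y, c⟩, h⟩, rfl⟩
    exact mon_mem (mem_exponents.mp h)

theorem linearIndependent_mon (n : ℕ) :
    LinearIndependent ℚ fun t : exponents n => mon t.1.1 t.1.2.1 t.1.2.2.1 t.1.2.2.2 := by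
  have hli := (basisMonomials (Fin 4) ℚ).linearIndependent
  rw [coe_basisMonomials] at hli
  refine hli.comp (fun t : exponents n => Finsupp.equivFunOnFinite.symm
    ![t.1.1, t.1.2.1, t.1.2.2.1, t.1.2.2.2]) fun t t' h => ?_
  have h := Finsupp.equivFunOnFinite.symm.injective h
  have key (i : Fin 4) := congrFun h i
  exact Subtype.ext (Prod.ext (key 0) (Prod.ext (key 1) (Prod.ext (key 2) (key 3))))

theorem finrank_weightedHomogeneousSubmodule_five :
    Module.finrank ℚ (weightedHomogeneousSubmodule ℚ wt 5) = 20 := by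
  rw [weightedHomogeneousSubmodule_eq_span, finrank_span_eq_card (linearIndependent_mon 5),
    Fintype.card_coe, card_exponents_five]

instance (n : ℕ) : Module.Finite ℚ (weightedHomogeneousSubmodule ℚ wt n) := by
  rw [weightedHomogeneousSubmodule_eq_span]
  exact Module.Finite.span_of_finite ℚ (Set.finite_range _)

/-- The products of `r` with the monomials of weight `n`. -/
def multiples (n : ℕ) (r : P4) : Finset P4 := by
  classical
  exact (exponents n).image fun t => mon t.1 t.2.1 t.2.2.1 t.2.2.2 * r

theorem card_multiples_le (n : ℕ) (r : P4) : (multiples n r).card ≤ (exponents n).card :=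
  Finset.card_image_le

theorem mon_mul_mem_multiples {n a b y c : ℕ} (h : a + b + 2*y + 2*c = n) (r : P4) :
    mon a b y c * r ∈ multiples n r := by
  classical
  exact Finset.mem_image.mpr ⟨(a, b, y, c), mem_exponents.mpr h, rfl⟩

theorem weightedHomogeneousComponent_mul_mem {k m : ℕ} {r : P4}
    (hr : r ∈ weightedHomogeneousSubmodule ℚ wt k) (q : P4) :
    weightedHomogeneousComponent wt (m + k) (q * r) ∈
      Submodule.span ℚ (multiples m r : Set P4) := by
  induction q using MvPolynomial.induction_on' with
  | monomial d s =>
    have hd : IsWeightedHomogeneous wt (monomial d s) (Finsupp.weight wt d) :=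
      isWeightedHomogeneous_monomial _ _ _ rfl
    rw [weightedHomogeneousComponent_of_mem (hd.mul hr)]
    split_ifs with h
    · rw [monomial_eq_smul_mon, smul_mul_assoc]
      refine Submodule.smul_mem _ _ (Submodule.subset_span (mon_mul_mem_multiples ?_ r))
      rw [← weight_wt]
      omega
    · exact zero_mem _
  | add p q hp hq =>
    rw [add_mul, map_add]
    exact add_mem hp hq

theorem eq_zero_of_relations {g : ℚ} (hg : 0 ≤ g) {F : ℕ → ℕ → ℕ → ℕ → ℚ}
    (h₁ : ∀ a b y c, a + b + 2*y + 2*c = 2 →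
      (1064*g + 3610)*F (a+3) b y c - 1074*F (a+2) (b+1) y c - (2148*g + 7272)*F (a+1) b (y+1) c
        - (1064*g^3 + 10830*g^2 + 36680*g + 41360)*F (a+1) b y (c+1) + 2160*F a (b+1) (y+1) c
        + (1074*g^2 + 7272*g + 12288)*F a (b+1) y (c+1) = 0)
    (h₂ : ∀ a b y c, a + b + 2*y + 2*c = 2 →
      -(6412*g + 21255)*F (a+3) b y c + 6207*F (a+2) (b+1) y c
        + (12414*g + 40896)*F (a+1) b (y+1) c
        + (6412*g^3 + 63765*g^2 + 211540*g + 234480)*F (a+1) b y (c+1) - 11880*F a (b+1) (y+1) c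
        - (6207*g^2 + 40896*g + 68184)*F a (b+1) y (c+1) = 0)
    (h₃ : ∀ a b y c, a + b + 2*y + 2*c = 1 →
      -(22845*g + 67763)*F (a+4) b y c + 18141*F (a+3) (b+1) y c
        + (54423*g + 146550)*F (a+2) b (y+1) c
        + (45690*g^3 + 406578*g^2 + 1184220*g + 1123060)*F (a+2) b y (c+1)
        - 35640*F (a+1) (b+1) (y+1) c - (54423*g^2 + 293100*g + 372648)*F (a+1) (b+1) y (c+1)
        + (17820*g + 24840)*F a (b+2) y (c+1) - (17820*g + 24840)*F a b (y+2) c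
        - (18141*g^3 + 146550*g^2 + 372648*g + 283824)*F a b (y+1) (c+1)
        - (4569*g^5 + 67763*g^4 + 394740*g^3 + 1123060*g^2 + 1546176*g + 810432)*F a b y (c+2) = 0)
    (h₄ : ∀ a b y c, a + b + 2*y + 2*c = 1 →
      133*F (a+4) b y c - 537*F (a+2) b (y+1) c - (798*g^2 + 5415*g + 9170)*F (a+2) b y (c+1)
        + (1074*g + 3636)*F (a+1) (b+1) y (c+1) - 540*F a (b+2) y (c+1) + 540*F a b (y+2) c
        + (537*g^2 + 3636*g + 6144)*F a b (y+1) (c+1)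
        + (133*g^4 + 1805*g^3 + 9170*g^2 + 20680*g + 17472)*F a b y (c+2) = 0)
    (h₅ : ∀ a b y c, a + b + 2*y + 2*c = 1 →
      -(18545*g + 68407)*F (a+4) b y c + 15261*F (a+3) (b+1) y c
        + (45783*g + 175866)*F (a+2) b (y+1) c
        + (37090*g^3 + 410442*g^2 + 1499460*g + 1811300)*F (a+2) b y (c+1)
        - 31320*F (a+1) (b+1) (y+1) c - (45783*g^2 + 351732*g + 662976)*F (a+1) (b+1) y (c+1)
        + (15660*g + 72360)*F a (b+2) y (c+1) - (15660*g + 72360)*F a b (y+2) c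
        - (15261*g^3 + 175866*g^2 + 662976*g + 822096)*F a b (y+1) (c+1)
        - (3709*g^5 + 68407*g^4 + 499820*g^3 + 1811300*g^2 + 3260256*g + 2334528)*F a b y (c+2)
        = 0)
    (hb₁ : F 1 4 0 0 = 0) (hb₂ : F 1 0 0 2 = 0) (hb₃ : F 0 5 0 0 = 0) (hb₄ : F 0 1 0 2 = 0)
    {a b y c : ℕ} (hd : a + b + 2*y + 2*c = 5) : F a b y c = 0 := by
  have hs₂ : ∀ a b y c, a + b + 2*y + 2*c = 2 →
      -(28*g + 70)*F (a+3) b y c + 15*F (a+2) (b+1) y c + (30*g + 45)*F (a+1) b (y+1) c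
        + (28*g^3 + 210*g^2 + 490*g + 350)*F (a+1) b y (c+1)
        - (15*g^2 + 45*g + 30)*F a (b+1) y (c+1) = 0 := by
    intro a b y c h
    linear_combination (2*h₂ a b y c h + 11*h₁ a b y c h) / 40
  have hs₃ : ∀ a b y c, a + b + 2*y + 2*c = 1 →
      -(18456*g + 61645)*F (a+4) b y c + 18141*F (a+3) (b+1) y c
        + (36702*g + 121848)*F (a+2) b (y+1) c
        + (19356*g^3 + 191175*g^2 + 632520*g + 701240)*F (a+2) b y (c+1)
        - 35640*F (a+1) (b+1) (y+1) c - (18981*g^2 + 123708*g + 205392)*F (a+1) (b+1) y (c+1)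
        - (420*g^3 + 1860*g^2 + 2640*g + 1200)*F a b (y+1) (c+1)
        - (180*g^5 + 2080*g^4 + 9100*g^3 + 18800*g^2 + 18320*g + 6720)*F a b y (c+2) = 0 := by
    intro a b y c h
    linear_combination (h₃ a b y c h + (33*g + 46)*h₄ a b y c h)
  have ht₅ : ∀ a b y c, a + b + 2*y + 2*c = 1 →
      (12630*g + 29600)*F (a+4) b y c - 5619*F (a+3) (b+1) y c
        - (16857*g + 26157)*F (a+2) b (y+1) c
        - (25260*g^3 + 177600*g^2 + 395430*g + 278200)*F (a+2) b y (c+1)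
        + (16857*g^2 + 52314*g + 39138)*F (a+1) (b+1) y (c+1)
        + (5619*g^3 + 26157*g^2 + 39138*g + 18600)*F a b (y+1) (c+1)
        + (2526*g^5 + 29600*g^4 + 131810*g^3 + 278200*g^2 + 277624*g + 104160)*F a b y (c+2)
        = 0 := by
    intro a b y c h
    linear_combination (33*(h₅ a b y c h + (29*g + 134)*h₄ a b y c h) - 29*hs₃ a b y c h) / 4
  have r₁_2000 := h₁ 2 0 0 0 rfl
  have r₁_1100 := h₁ 1 1 0 0 rfl
  have r₁_0200 := h₁ 0 2 0 0 rfl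
  have r₁_0010 := h₁ 0 0 1 0 rfl
  have r₁_0001 := h₁ 0 0 0 1 rfl
  have s₂_2000 := hs₂ 2 0 0 0 rfl
  have s₂_1100 := hs₂ 1 1 0 0 rfl
  have s₂_0200 := hs₂ 0 2 0 0 rfl
  have s₂_0010 := hs₂ 0 0 1 0 rfl
  have s₂_0001 := hs₂ 0 0 0 1 rfl
  have s₃_1000 := hs₃ 1 0 0 0 rfl
  have s₃_0100 := hs₃ 0 1 0 0 rfl
  have r₄_1000 := h₄ 1 0 0 0 rfl
  have r₄_0100 := h₄ 0 1 0 0 rfl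
  have t₅_1000 := ht₅ 1 0 0 0 rfl
  have t₅_0100 := ht₅ 0 1 0 0 rfl
  simp only [Nat.reduceAdd, zero_add, hb₂, hb₄, mul_zero]
    at r₁_2000 r₁_1100 r₁_0200 r₁_0010 r₁_0001 s₂_2000 s₂_1100 s₂_0200
  simp only [Nat.reduceAdd, zero_add, hb₂, hb₄, mul_zero]
    at s₂_0010 s₂_0001 s₃_1000 s₃_0100 r₄_1000 r₄_0100 t₅_1000 t₅_0100
  replace r₁_1100 : (45*g + 104)*F 4 1 0 0 - 21*F 3 2 0 0 - (63*g + 93)*F 2 1 1 0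
      - (90*g^3 + 624*g^2 + 1365*g + 940)*F 2 1 0 1 + (63*g^2 + 186*g + 132)*F 1 2 0 1
      + (21*g^3 + 93*g^2 + 132*g + 60)*F 0 1 1 1 = 0 := by
    linear_combination ((-33)*r₁_1100/2 - s₃_0100) / 20
  replace s₂_0010 : -(266*g + 399)*F 5 0 0 0 + (66*g - 909)*F 3 0 1 0
      + (1596*g^3 + 13224*g^2 + 34585*g + 27510)*F 3 0 0 1 + 540*F 2 1 1 0
      - (2148*g^2 + 10494*g + 10908)*F 2 1 0 1 + (1080*g + 1620)*F 1 2 0 1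
      - (66*g^3 + 1323*g^2 + 5556*g + 5832)*F 1 0 1 1 - (540*g^2 + 1620*g + 1080)*F 0 1 1 1
      = 0 := by
    linear_combination 36*s₂_0010 - (2*g + 3)*r₄_1000
  replace s₂_1100 : (29*g + 30)*F 4 1 0 0 - (105*g + 150)*F 2 1 1 0
      - (254*g^3 + 1650*g^2 + 3395*g + 2250)*F 2 1 0 1 + (210*g^2 + 615*g + 450)*F 1 2 0 1
      + (105*g^3 + 465*g^2 + 660*g + 300)*F 0 1 1 1 = 0 := by
    linear_combination 7*s₂_1100 + 5*r₁_1100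
  replace t₅_0100 : (125*g + 376)*F 4 1 0 0 - 270*F 2 1 1 0
      - (250*g^3 + 2256*g^2 + 6405*g + 5660)*F 2 1 0 1 + (540*g + 810)*F 1 2 0 1
      + (270*g^2 + 810*g + 540)*F 0 1 1 1 = 0 := by
    linear_combination (7*t₅_0100 - 1873*r₁_1100) / 33
  replace s₂_1100 : -(2088*g + 2160)*F 4 1 0 0
      + (3724*g^4 + 29127*g^3 + 79363*g^2 + 90060*g + 36100)*F 3 0 0 1
      + (7560*g + 10800)*F 2 1 1 0 + (14529*g^3 + 102153*g^2 + 220812*g + 151260)*F 2 1 0 1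
      - (15120*g^2 + 44280*g + 32400)*F 1 2 0 1
      - (7518*g^4 + 58746*g^3 + 159972*g^2 + 181464*g + 72720)*F 1 0 1 1 = 0 := by
    linear_combination (-72)*s₂_1100 + (7*g^3 + 31*g^2 + 44*g + 20)*r₁_0001/2
  replace s₂_0010 : -(532*g + 798)*F 5 0 0 0 + (132*g - 1818)*F 3 0 1 0
      + (3724*g^3 + 29849*g^2 + 75649*g + 58630)*F 3 0 0 1 + 1080*F 2 1 1 0
      - (4833*g^2 + 22599*g + 22890)*F 2 1 0 1 + (2160*g + 3240)*F 1 2 0 1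
      - (1206*g^3 + 9504*g^2 + 24168*g + 18936)*F 1 0 1 1 = 0 := by
    linear_combination 2*s₂_0010 + (g^2 + 3*g + 2)*r₁_0001/2
  replace t₅_0100 : -(500*g + 1504)*F 4 1 0 0 + (532*g^3 + 3401*g^2 + 6479*g + 3610)*F 3 0 0 1
      + 1080*F 2 1 1 0 + (1000*g^3 + 8487*g^2 + 24009*g + 21566)*F 2 1 0 1
      - (2160*g + 3240)*F 1 2 0 1 - (1074*g^3 + 6858*g^2 + 13056*g + 7272)*F 1 0 1 1 = 0 := by
    linear_combination (-4)*t₅_0100 + (g^2 + 3*g + 2)*r₁_0001/2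
  replace r₁_2000 : (532*g + 1805)*F 5 0 0 0 + (500*g + 967)*F 4 1 0 0 - (1074*g + 3636)*F 3 0 1 0
      - (1064*g^3 + 8816*g^2 + 24819*g + 24290)*F 3 0 0 1
      - (1000*g^3 + 7950*g^2 + 20373*g + 15422)*F 2 1 0 1 + (2160*g + 3240)*F 1 2 0 1
      + (1074*g^3 + 6858*g^2 + 13056*g + 7272)*F 1 0 1 1 = 0 := by
    linear_combination r₁_2000/2 - t₅_0100
  replace s₂_1100 : F 4 1 0 0 - (2*g^2 + 8*g + 5)*F 2 1 0 1 = 0 := by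
    refine (mul_eq_zero.mp ?_).resolve_left (show 3500*g^2 + 13440*g + 12880 ≠ 0 by positivity)
    linear_combination s₂_1100 - (7*g + 10)*t₅_0100
  replace s₂_0010 : -(266*g + 399)*F 5 0 0 0 + (250*g + 752)*F 4 1 0 0 + (66*g - 909)*F 3 0 1 0
      + (1596*g^3 + 13224*g^2 + 34585*g + 27510)*F 3 0 0 1
      - (500*g^3 + 6660*g^2 + 23304*g + 22228)*F 2 1 0 1 + (2160*g + 3240)*F 1 2 0 1
      - (66*g^3 + 1323*g^2 + 5556*g + 5832)*F 1 0 1 1 = 0 := by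
    linear_combination (s₂_0010 - t₅_0100) / 2
  replace s₃_1000 : (18456*g + 61645)*F 5 0 0 0 + (16500*g + 31491)*F 4 1 0 0
      - (36702*g + 121848)*F 3 0 1 0 - (36912*g^3 + 303408*g^2 + 846327*g + 820370)*F 3 0 0 1
      - (33000*g^3 + 261090*g^2 + 668589*g + 506286)*F 2 1 0 1 + (71280*g + 106920)*F 1 2 0 1
      + (35862*g^3 + 228174*g^2 + 433488*g + 241176)*F 1 0 1 1 = 0 := by
    linear_combination (-1)*s₃_1000 - 33*t₅_0100
  replace r₁_2000 : (532*g + 1805)*F 5 0 0 0 - (1074*g + 3636)*F 3 0 1 0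
      - (1064*g^3 + 8816*g^2 + 24819*g + 24290)*F 3 0 0 1 - (2016*g^2 + 10137*g + 10587)*F 2 1 0 1
      + (2160*g + 3240)*F 1 2 0 1 + (1074*g^3 + 6858*g^2 + 13056*g + 7272)*F 1 0 1 1 = 0 := by
    linear_combination r₁_2000 - (500*g + 967)*s₂_1100
  replace s₂_2000 : -(28*g + 70)*F 5 0 0 0 + (30*g + 45)*F 3 0 1 0
      + (28*g^3 + 210*g^2 + 490*g + 350)*F 3 0 0 1 + (15*g^2 + 75*g + 45)*F 2 1 0 1 = 0 := by
    linear_combination s₂_2000 - 15*s₂_1100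
  replace s₂_0010 : -(266*g + 399)*F 5 0 0 0 + (66*g - 909)*F 3 0 1 0
      + (1596*g^3 + 13224*g^2 + 34585*g + 27510)*F 3 0 0 1
      - (3156*g^2 + 16038*g + 18468)*F 2 1 0 1 + (2160*g + 3240)*F 1 2 0 1
      - (66*g^3 + 1323*g^2 + 5556*g + 5832)*F 1 0 1 1 = 0 := by
    linear_combination s₂_0010 - (250*g + 752)*s₂_1100
  replace s₃_1000 : (18456*g + 61645)*F 5 0 0 0 - (36702*g + 121848)*F 3 0 1 0
      - (36912*g^3 + 303408*g^2 + 846327*g + 820370)*F 3 0 0 1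
      - (66108*g^2 + 334161*g + 348831)*F 2 1 0 1 + (71280*g + 106920)*F 1 2 0 1
      + (35862*g^3 + 228174*g^2 + 433488*g + 241176)*F 1 0 1 1 = 0 := by
    linear_combination s₃_1000 - (16500*g + 31491)*s₂_1100
  replace t₅_1000 : -(12630*g + 29600)*F 5 0 0 0 + (16857*g + 26157)*F 3 0 1 0
      + (25260*g^3 + 177600*g^2 + 395430*g + 278200)*F 3 0 0 1
      - (5619*g^2 + 7362*g + 11043)*F 2 1 0 1 - (5619*g^3 + 26157*g^2 + 39138*g + 18600)*F 1 0 1 1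
      = 0 := by
    linear_combination (-1)*t₅_1000 - 5619*s₂_1100
  replace r₁_2000 : (2660*g + 9025)*F 5 0 0 0 - (5370*g + 18180)*F 3 0 1 0
      - (24136*g^3 + 185732*g^2 + 459437*g + 368480)*F 3 0 0 1 + (10800*g + 16200)*F 1 2 0 1
      + (25530*g^3 + 165900*g^2 + 323205*g + 195165)*F 1 0 1 1 = 0 := by
    linear_combination 5*r₁_2000 + (672*g^2 + 3379*g + 3529)*s₂_0001
  replace s₂_2000 : -(28*g + 70)*F 5 0 0 0 + (30*g + 45)*F 3 0 1 0
      + (56*g^3 + 420*g^2 + 924*g + 560)*F 3 0 0 1 - (30*g^3 + 195*g^2 + 315*g + 135)*F 1 0 1 1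
      = 0 := by
    linear_combination s₂_2000 - (g^2 + 5*g + 3)*s₂_0001
  replace s₂_0010 : -(1330*g + 1995)*F 5 0 0 0 + (330*g - 4545)*F 3 0 1 0
      - (21476*g^3 + 157208*g^2 + 373663*g + 293370)*F 3 0 0 1 + (10800*g + 16200)*F 1 2 0 1
      + (31230*g^3 + 201105*g^2 + 397470*g + 247860)*F 1 0 1 1 = 0 := by
    linear_combination 5*s₂_0010 + (1052*g^2 + 5346*g + 6156)*s₂_0001
  replace s₃_1000 : (92280*g + 308225)*F 5 0 0 0 - (183510*g + 609240)*F 3 0 1 0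
      - (801568*g^3 + 6178396*g^2 + 15284481*g + 12241240)*F 3 0 0 1
      + (356400*g + 534600)*F 1 2 0 1
      + (840390*g^3 + 5474100*g^2 + 10668165*g + 6438345)*F 1 0 1 1 = 0 := by
    linear_combination 5*s₃_1000 + (22036*g^2 + 111387*g + 116277)*s₂_0001
  replace t₅_1000 : -(63150*g + 148000)*F 5 0 0 0 + (84285*g + 130785)*F 3 0 1 0
      + (73856*g^3 + 688178*g^2 + 1702302*g + 1133330)*F 3 0 0 1
      + (28095*g^3 + 27120*g^2 + 25170*g + 72645)*F 1 0 1 1 = 0 := by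
    linear_combination 5*t₅_1000 + (1873*g^2 + 2454*g + 3681)*s₂_0001
  replace s₂_0010 : (3990*g + 11020)*F 5 0 0 0 - (5700*g + 13635)*F 3 0 1 0
      - (2660*g^3 + 28524*g^2 + 85774*g + 75110)*F 3 0 0 1
      - (5700*g^3 + 35205*g^2 + 74265*g + 52695)*F 1 0 1 1 = 0 := by
    linear_combination (-1)*s₂_0010 + r₁_2000
  replace s₃_1000 : (225*g + 520)*F 5 0 0 0 - (315*g + 465)*F 3 0 1 0
      - (254*g^3 + 2462*g^2 + 6153*g + 4070)*F 3 0 0 1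
      + (-105*g^3 - 30*g^2 + 120*g - 105)*F 1 0 1 1 = 0 := by
    linear_combination (s₃_1000 - 33*r₁_2000) / 20
  replace s₂_0010 : (1330*g^2 + 9021*g + 15285)*F 5 0 0 0
      - (7980*g^4 + 72738*g^3 + 237890*g^2 + 322587*g + 141855)*F 3 0 0 1
      + (11400*g^4 + 94440*g^3 + 275550*g^2 + 332910*g + 140400)*F 1 0 1 1 = 0 := by
    linear_combination ((-2*g - 3)*s₂_0010 - (380*g + 909)*s₂_2000) / 2
  replace s₃_1000 : -(138*g^2 + 623*g + 610)*F 5 0 0 0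
      + (668*g^4 + 4870*g^3 + 12732*g^2 + 13805*g + 5150)*F 3 0 0 1
      - (840*g^4 + 5400*g^3 + 12510*g^2 + 12450*g + 4500)*F 1 0 1 1 = 0 := by
    linear_combination (2*g + 3)*s₃_1000 + (21*g + 31)*s₂_2000
  replace t₅_1000 : -(15516*g^2 + 76006*g + 83165)*F 5 0 0 0
      + (83476*g^4 + 625160*g^3 + 1692399*g^2 + 1914715*g + 741325)*F 3 0 0 1
      - (112380*g^4 + 747900*g^3 + 1800945*g^2 + 1862925*g + 697500)*F 1 0 1 1 = 0 := by
    linear_combination ((-2*g - 3)*t₅_1000 + (5619*g + 8719)*s₂_2000) / 2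
  replace s₂_0010 : (13300*g^3 + 83491*g^2 + 157136*g + 86820)*F 3 0 0 1
      - (28500*g^3 + 179205*g^2 + 338055*g + 187350)*F 1 0 1 1 = 0 := by
    refine (mul_eq_zero.mp ?_).resolve_left (show 16*g^3 + 88*g^2 + 156*g + 90 ≠ 0 by positivity)
    linear_combination (-138*g^2 - 623*g - 610)*s₂_0010 - (1330*g^2 + 9021*g + 15285)*s₃_1000
  replace t₅_1000 : 7*F 3 0 0 1 - 15*F 1 0 1 1 = 0 := by
    refine (mul_eq_zero.mp ?_).resolve_left (show
      165000*g^6 + 1706100*g^5 + 7241850*g^4 + 16146075*g^3 + 19929525*g^2 + 12899700*g + 3415500 ≠ 0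
      by positivity)
    linear_combination (138*g^2 + 623*g + 610)*t₅_1000 - (15516*g^2 + 76006*g + 83165)*s₃_1000
  replace s₂_0010 : F 3 0 0 1 = 0 := by
    refine (mul_eq_zero.mp ?_).resolve_left (show 138*g^2 + 623*g + 610 ≠ 0 by positivity)
    linear_combination (-1)*s₂_0010 + (1900*g^3 + 11947*g^2 + 22537*g + 12490)*t₅_1000
  have z3001 : F 3 0 0 1 = 0 := by
    linear_combination s₂_0010
  have z1011 : F 1 0 1 1 = 0 := by
    refine (mul_eq_zero.mp ?_).resolve_left (show 15 ≠ 0 by positivity)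
    linear_combination -t₅_1000 + 7*z3001
  have z5000 : F 5 0 0 0 = 0 := by
    refine (mul_eq_zero.mp ?_).resolve_left (show 138*g^2 + 623*g + 610 ≠ 0 by positivity)
    linear_combination -s₃_1000 + (668*g^4 + 4870*g^3 + 12732*g^2 + 13805*g + 5150)*z3001
      - (840*g^4 + 5400*g^3 + 12510*g^2 + 12450*g + 4500)*z1011
  have z3010 : F 3 0 1 0 = 0 := by
    refine (mul_eq_zero.mp ?_).resolve_left (show 30*g + 45 ≠ 0 by positivity)
    linear_combination s₂_2000 + (28*g + 70)*z5000 - (56*g^3 + 420*g^2 + 924*g + 560)*z3001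
      + (30*g^3 + 195*g^2 + 315*g + 135)*z1011
  have z1201 : F 1 2 0 1 = 0 := by
    refine (mul_eq_zero.mp ?_).resolve_left (show 10800*g + 16200 ≠ 0 by positivity)
    linear_combination r₁_2000 - (2660*g + 9025)*z5000 + (5370*g + 18180)*z3010
      + (24136*g^3 + 185732*g^2 + 459437*g + 368480)*z3001
      - (25530*g^3 + 165900*g^2 + 323205*g + 195165)*z1011
  have z2101 : F 2 1 0 1 = 0 := by
    refine (mul_eq_zero.mp ?_).resolve_left (show 15 ≠ 0 by positivity)
    linear_combination s₂_0001 + (28*g + 70)*z3001 - (30*g + 45)*z1011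
  have z4100 : F 4 1 0 0 = 0 := by
    linear_combination s₂_1100 + (2*g^2 + 8*g + 5)*z2101
  have z2110 : F 2 1 1 0 = 0 := by
    refine (mul_eq_zero.mp ?_).resolve_left (show 1080 ≠ 0 by positivity)
    linear_combination t₅_0100 + (500*g + 1504)*z4100
      - (1000*g^3 + 8487*g^2 + 24009*g + 21566)*z2101 + (2160*g + 3240)*z1201
      - (532*g^3 + 3401*g^2 + 6479*g + 3610)*z3001 + (1074*g^3 + 6858*g^2 + 13056*g + 7272)*z1011
  have z0111 : F 0 1 1 1 = 0 := by
    refine (mul_eq_zero.mp ?_).resolve_left (show 1080 ≠ 0 by positivity)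
    linear_combination r₁_0001/2 - (532*g + 1805)*z3001 + 537*z2101 + (1074*g + 3636)*z1011
  have z3200 : F 3 2 0 0 = 0 := by
    refine (mul_eq_zero.mp ?_).resolve_left (show 21 ≠ 0 by positivity)
    linear_combination -r₁_1100 + (45*g + 104)*z4100 - (63*g + 93)*z2110
      - (90*g^3 + 624*g^2 + 1365*g + 940)*z2101 + (63*g^2 + 186*g + 132)*z1201
      + (21*g^3 + 93*g^2 + 132*g + 60)*z0111
  have z1020 : F 1 0 2 0 = 0 := by
    refine (mul_eq_zero.mp ?_).resolve_left (show 540 ≠ 0 by positivity)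
    linear_combination r₄_1000 - 133*z5000 + 537*z3010 + (798*g^2 + 5415*g + 9170)*z3001
      - (1074*g + 3636)*z2101 + 540*z1201 - (537*g^2 + 3636*g + 6144)*z1011
  have z1210 : F 1 2 1 0 = 0 := by
    refine (mul_eq_zero.mp ?_).resolve_left (show 35640 ≠ 0 by positivity)
    linear_combination -s₃_0100 - (18456*g + 61645)*z4100 + 18141*z3200 + (36702*g + 121848)*z2110
      + (19356*g^3 + 191175*g^2 + 632520*g + 701240)*z2101 - (18981*g^2 + 123708*g + 205392)*z1201
      - (420*g^3 + 1860*g^2 + 2640*g + 1200)*z0111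
  have z0120 : F 0 1 2 0 = 0 := by
    refine (mul_eq_zero.mp ?_).resolve_left (show 1080 ≠ 0 by positivity)
    linear_combination r₁_0010/2 - (532*g + 1805)*z3010 + 537*z2110 + (1074*g + 3636)*z1020
      + (532*g^3 + 5415*g^2 + 18340*g + 20680)*z1011 - (537*g^2 + 3636*g + 6144)*z0111
  have z0301 : F 0 3 0 1 = 0 := by
    refine (mul_eq_zero.mp ?_).resolve_left (show 540 ≠ 0 by positivity)
    linear_combination -r₄_0100 + 133*z4100 - 537*z2110 - (798*g^2 + 5415*g + 9170)*z2101
      + (1074*g + 3636)*z1201 + 540*z0120 + (537*g^2 + 3636*g + 6144)*z0111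
  have z2300 : F 2 3 0 0 = 0 := by
    refine (mul_eq_zero.mp ?_).resolve_left (show 15 ≠ 0 by positivity)
    linear_combination s₂_0200 + (28*g + 70)*z3200 - (30*g + 45)*z1210
      - (28*g^3 + 210*g^2 + 490*g + 350)*z1201 + (15*g^2 + 45*g + 30)*z0301
  have z0310 : F 0 3 1 0 = 0 := by
    refine (mul_eq_zero.mp ?_).resolve_left (show 1080 ≠ 0 by positivity)
    linear_combination r₁_0200/2 - (532*g + 1805)*z3200 + 537*z2300 + (1074*g + 3636)*z1210
      + (532*g^3 + 5415*g^2 + 18340*g + 20680)*z1201 - (537*g^2 + 3636*g + 6144)*z0301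
  obtain ⟨hy, hc, ha⟩ : y ≤ 2 ∧ c ≤ 2 ∧ a ≤ 5 := by omega
  obtain rfl : b = 5 - a - 2*y - 2*c := by omega
  interval_cases y <;> interval_cases c <;> interval_cases a <;> omega

theorem r1_eq (g : ℤ) : r1 g =
    (1064*(g:ℚ) + 3610) • mon 3 0 0 0 - (1074 : ℚ) • mon 2 1 0 0
      - (2148*(g:ℚ) + 7272) • mon 1 0 1 0
      - (1064*(g:ℚ)^3 + 10830*(g:ℚ)^2 + 36680*(g:ℚ) + 41360) • mon 1 0 0 1
      + (2160 : ℚ) • mon 0 1 1 0 + (1074*(g:ℚ)^2 + 7272*(g:ℚ) + 12288) • mon 0 1 0 1 := by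
  simp only [r1, mon_eq, smul_eq_C_mul]
  ring

theorem r2_eq (g : ℤ) : r2 g =
    -(6412*(g:ℚ) + 21255) • mon 3 0 0 0 + (6207 : ℚ) • mon 2 1 0 0
      + (12414*(g:ℚ) + 40896) • mon 1 0 1 0
      + (6412*(g:ℚ)^3 + 63765*(g:ℚ)^2 + 211540*(g:ℚ) + 234480) • mon 1 0 0 1
      - (11880 : ℚ) • mon 0 1 1 0 - (6207*(g:ℚ)^2 + 40896*(g:ℚ) + 68184) • mon 0 1 0 1 := by
  simp only [r2, mon_eq, smul_eq_C_mul, map_neg]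
  ring

theorem r3_eq (g : ℤ) : r3 g =
    -(22845*(g:ℚ) + 67763) • mon 4 0 0 0 + (18141 : ℚ) • mon 3 1 0 0
      + (54423*(g:ℚ) + 146550) • mon 2 0 1 0
      + (45690*(g:ℚ)^3 + 406578*(g:ℚ)^2 + 1184220*(g:ℚ) + 1123060) • mon 2 0 0 1
      - (35640 : ℚ) • mon 1 1 1 0 - (54423*(g:ℚ)^2 + 293100*(g:ℚ) + 372648) • mon 1 1 0 1
      + (17820*(g:ℚ) + 24840) • mon 0 2 0 1 - (17820*(g:ℚ) + 24840) • mon 0 0 2 0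
      - (18141*(g:ℚ)^3 + 146550*(g:ℚ)^2 + 372648*(g:ℚ) + 283824) • mon 0 0 1 1
      - (4569*(g:ℚ)^5 + 67763*(g:ℚ)^4 + 394740*(g:ℚ)^3 + 1123060*(g:ℚ)^2 + 1546176*(g:ℚ) + 810432) • mon 0 0 0 2 := by
  simp only [r3, mon_eq, smul_eq_C_mul, map_neg]
  ring

theorem r4_eq (g : ℤ) : r4 g =
    (133 : ℚ) • mon 4 0 0 0 - (537 : ℚ) • mon 2 0 1 0
      - (798*(g:ℚ)^2 + 5415*(g:ℚ) + 9170) • mon 2 0 0 1 + (1074*(g:ℚ) + 3636) • mon 1 1 0 1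
      - (540 : ℚ) • mon 0 2 0 1 + (540 : ℚ) • mon 0 0 2 0
      + (537*(g:ℚ)^2 + 3636*(g:ℚ) + 6144) • mon 0 0 1 1
      + (133*(g:ℚ)^4 + 1805*(g:ℚ)^3 + 9170*(g:ℚ)^2 + 20680*(g:ℚ) + 17472) • mon 0 0 0 2 := by
  simp only [r4, mon_eq, smul_eq_C_mul]
  ring

theorem r5_eq (g : ℤ) : r5 g =
    -(18545*(g:ℚ) + 68407) • mon 4 0 0 0 + (15261 : ℚ) • mon 3 1 0 0
      + (45783*(g:ℚ) + 175866) • mon 2 0 1 0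
      + (37090*(g:ℚ)^3 + 410442*(g:ℚ)^2 + 1499460*(g:ℚ) + 1811300) • mon 2 0 0 1
      - (31320 : ℚ) • mon 1 1 1 0 - (45783*(g:ℚ)^2 + 351732*(g:ℚ) + 662976) • mon 1 1 0 1
      + (15660*(g:ℚ) + 72360) • mon 0 2 0 1 - (15660*(g:ℚ) + 72360) • mon 0 0 2 0
      - (15261*(g:ℚ)^3 + 175866*(g:ℚ)^2 + 662976*(g:ℚ) + 822096) • mon 0 0 1 1
      - (3709*(g:ℚ)^5 + 68407*(g:ℚ)^4 + 499820*(g:ℚ)^3 + 1811300*(g:ℚ)^2 + 3260256*(g:ℚ) + 2334528) • mon 0 0 0 2 := by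
  simp only [r5, mon_eq, smul_eq_C_mul, map_neg]
  ring

theorem r1_mem (g : ℤ) : r1 g ∈ weightedHomogeneousSubmodule ℚ wt 3 := by
  rw [r1_eq]
  repeat' first | apply add_mem | apply sub_mem
  all_goals exact Submodule.smul_mem _ _ (mon_mem rfl)

theorem r2_mem (g : ℤ) : r2 g ∈ weightedHomogeneousSubmodule ℚ wt 3 := by
  rw [r2_eq]
  repeat' first | apply add_mem | apply sub_mem | apply neg_mem
  all_goals exact Submodule.smul_mem _ _ (mon_mem rfl)

theorem r3_mem (g : ℤ) : r3 g ∈ weightedHomogeneousSubmodule ℚ wt 4 := by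
  rw [r3_eq]
  repeat' first | apply add_mem | apply sub_mem | apply neg_mem
  all_goals exact Submodule.smul_mem _ _ (mon_mem rfl)

theorem r4_mem (g : ℤ) : r4 g ∈ weightedHomogeneousSubmodule ℚ wt 4 := by
  rw [r4_eq]
  repeat' first | apply add_mem | apply sub_mem
  all_goals exact Submodule.smul_mem _ _ (mon_mem rfl)

theorem r5_mem (g : ℤ) : r5 g ∈ weightedHomogeneousSubmodule ℚ wt 4 := by
  rw [r5_eq]
  repeat' first | apply add_mem | apply sub_mem | apply neg_mem
  all_goals exact Submodule.smul_mem _ _ (mon_mem rfl)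

/-- The degree-5 multiples of the relations by monomials. -/
def relations (g : ℤ) : Finset P4 := by
  classical
  exact multiples 2 (r1 g) ∪ multiples 2 (r2 g) ∪ multiples 1 (r3 g) ∪ multiples 1 (r4 g) ∪
    multiples 1 (r5 g)

theorem mem_relations {g : ℤ} {p : P4} : p ∈ relations g ↔
    p ∈ multiples 2 (r1 g) ∨ p ∈ multiples 2 (r2 g) ∨ p ∈ multiples 1 (r3 g) ∨
      p ∈ multiples 1 (r4 g) ∨ p ∈ multiples 1 (r5 g) := by
  classical
  simp only [relations, Finset.mem_union, or_assoc]

theorem card_relations_le (g : ℤ) : (relations g).card ≤ 16 := by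
  classical
  have h₁ := card_multiples_le 2 (r1 g)
  have h₂ := card_multiples_le 2 (r2 g)
  have h₃ := card_multiples_le 1 (r3 g)
  have h₄ := card_multiples_le 1 (r4 g)
  have h₅ := card_multiples_le 1 (r5 g)
  rw [card_exponents_two] at h₁ h₂
  rw [card_exponents_one] at h₃ h₄ h₅
  unfold relations
  repeat grw [Finset.card_union_le]
  omega

theorem multiples_subset {n : ℕ} {r : P4} {I : Ideal P4} (hr : r ∈ I) :
    (multiples n r : Set P4) ⊆ I := by
  classical
  intro p hp
  obtain ⟨t, -, rfl⟩ := Finset.mem_image.mp hp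
  exact I.mul_mem_left _ hr

theorem relations_subset (g : ℤ) : (relations g : Set P4) ⊆ Jg g := by
  intro p hp
  have hJ : ({r1 g, r2 g, r3 g, r4 g, r5 g} : Set P4) ⊆ Jg g := Ideal.subset_span
  simp only [Set.insert_subset_iff, Set.singleton_subset_iff] at hJ
  obtain ⟨h₁, h₂, h₃, h₄, h₅⟩ := hJ
  rcases mem_relations.mp hp with h | h | h | h | h
  exacts [multiples_subset h₁ h, multiples_subset h₂ h, multiples_subset h₃ h,
    multiples_subset h₄ h, multiples_subset h₅ h]

theorem mem_span_relations {g : ℤ} {p : P4} (hp : p ∈ weightedHomogeneousSubmodule ℚ wt 5)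
    (hJ : p ∈ Jg g) : p ∈ Submodule.span ℚ (relations g : Set P4) := by
  have hle {n : ℕ} {r : P4} (h : ∀ x ∈ multiples n r, x ∈ relations g) :
      Submodule.span ℚ (multiples n r : Set P4) ≤ Submodule.span ℚ (relations g : Set P4) :=
    Submodule.span_mono h
  simp only [Jg, Ideal.mem_span_insert, Ideal.mem_span_singleton'] at hJ
  obtain ⟨q₁, _, ⟨q₂, _, ⟨q₃, _, ⟨q₄, _, ⟨q₅, rfl⟩, rfl⟩, rfl⟩, rfl⟩, rfl⟩ := hJ
  rw [← weightedHomogeneousComponent_eq_self hp]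
  simp only [map_add]
  refine add_mem (hle ?_ (weightedHomogeneousComponent_mul_mem (m := 2) (r1_mem g) q₁)) <|
    add_mem (hle ?_ (weightedHomogeneousComponent_mul_mem (m := 2) (r2_mem g) q₂)) <|
    add_mem (hle ?_ (weightedHomogeneousComponent_mul_mem (m := 1) (r3_mem g) q₃)) <|
    add_mem (hle ?_ (weightedHomogeneousComponent_mul_mem (m := 1) (r4_mem g) q₄))
      (hle ?_ (weightedHomogeneousComponent_mul_mem (m := 1) (r5_mem g) q₅))
  all_goals
    intro x hx
    simp [mem_relations, hx]

/-- The four monomials `a₁a₂′⁴, a₁c₂², a₂′⁵, a₂′c₂²`. -/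
def basisMon : Fin 4 → P4 := ![mon 1 4 0 0, mon 1 0 0 2, mon 0 5 0 0, mon 0 1 0 2]

theorem basisMon_mem (i : Fin 4) : basisMon i ∈ weightedHomogeneousSubmodule ℚ wt 5 := by
  fin_cases i <;> exact mon_mem rfl

theorem weightedHomogeneousSubmodule_five_le {g : ℤ} (hg : 0 ≤ g) :
    weightedHomogeneousSubmodule ℚ wt 5 ≤
      Submodule.span ℚ (relations g) ⊔ Submodule.span ℚ (Set.range basisMon) := by
  refine weightedHomogeneousSubmodule_le fun a b y c hd => ?_
  by_contra hnot
  obtain ⟨f, hf, hker⟩ := Submodule.exists_le_ker_of_notMem hnot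
  obtain ⟨hr, hb⟩ := sup_le_iff.mp hker
  have hrel {n a b y c : ℕ} {r : P4} (h : a + b + 2*y + 2*c = n)
      (hsub : ∀ x ∈ multiples n r, x ∈ relations g) : f (mon a b y c * r) = 0 :=
    hr (Submodule.subset_span (hsub _ (mon_mul_mem_multiples h r)))
  have hbas (i : Fin 4) : f (basisMon i) = 0 := hb (Submodule.subset_span ⟨i, rfl⟩)
  refine hf (eq_zero_of_relations (g := g) (F := fun a b y c => f (mon a b y c))
    (by exact_mod_cast hg) ?_ ?_ ?_ ?_ ?_ (hbas 0) (hbas 1) (hbas 2) (hbas 3) hd)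
  · intro a b y c h
    simpa [r1_eq, mul_add, mul_sub, mon_mul_mon] using
      hrel h (r := r1 g) fun x hx => by simp [mem_relations, hx]
  · intro a b y c h
    simpa [r2_eq, mul_add, mul_sub, mon_mul_mon] using
      hrel h (r := r2 g) fun x hx => by simp [mem_relations, hx]
  · intro a b y c h
    simpa [r3_eq, mul_add, mul_sub, mon_mul_mon] using
      hrel h (r := r3 g) fun x hx => by simp [mem_relations, hx]
  · intro a b y c h
    simpa [r4_eq, mul_add, mul_sub, mon_mul_mon] using
      hrel h (r := r4 g) fun x hx => by simp [mem_relations, hx]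
  · intro a b y c h
    simpa [r5_eq, mul_add, mul_sub, mon_mul_mon] using
      hrel h (r := r5 g) fun x hx => by simp [mem_relations, hx]

theorem Smk_eq_zero_iff {g : ℤ} {p : P4} : Smk g p = 0 ↔ p ∈ Jg g :=
  Ideal.Quotient.eq_zero_iff_mem

theorem SComp_five_eq_span {g : ℤ} (hg : 0 ≤ g) :
    SComp g 5 = Submodule.span ℚ (Set.range (Smk g ∘ basisMon)) := by
  rw [Set.range_comp, ← Submodule.map_span]
  refine le_antisymm ?_ (Submodule.map_mono (Submodule.span_le.mpr ?_))
  · refine (Submodule.map_mono (weightedHomogeneousSubmodule_five_le hg)).trans ?_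
    rw [Submodule.map_sup, sup_le_iff]
    refine ⟨?_, le_rfl⟩
    rw [Submodule.map_span_le]
    intro p hp
    rw [Smk_eq_zero_iff.mpr (relations_subset g hp)]
    exact zero_mem _
  · rintro _ ⟨i, rfl⟩
    exact basisMon_mem i

theorem four_le_finrank_SComp_five (g : ℤ) : 4 ≤ Module.finrank ℚ (SComp g 5) := by
  set V := weightedHomogeneousSubmodule ℚ wt 5
  have hker : Module.finrank ℚ (LinearMap.ker ((Smk g).domRestrict V)) ≤ 16 := by
    rw [← Submodule.finrank_map_subtype_eq]
    refine (Submodule.finrank_mono (t := Submodule.span ℚ (relations g : Set P4)) ?_).trans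
      ((finrank_span_finset_le_card _).trans (card_relations_le g))
    rintro _ ⟨p, hp, rfl⟩
    exact mem_span_relations p.2 (Smk_eq_zero_iff.mp hp)
  have hrn := ((Smk g).domRestrict V).finrank_range_add_finrank_ker
  rw [LinearMap.range_domRestrict, finrank_weightedHomogeneousSubmodule_five] at hrn
  change Module.finrank ℚ (SComp g 5) + _ = 20 at hrn
  omega

/-- For `g > 101`, the images of `a₁a₂′⁴, a₁c₂², a₂′⁵, a₂′c₂²` form a `ℚ`-basis of `S(g)_5`;
in particular `dim_ℚ S(g)_5 = 4`. -/
theorem basis_SComp_five (g : ℤ) (hg : g > 101) :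
    LinearIndependent ℚ
      ![Smk g (a1 * a2'^4), Smk g (a1 * c2^2), Smk g (a2'^5), Smk g (a2' * c2^2)] ∧
    SComp g 5 = Submodule.span ℚ
      {Smk g (a1 * a2'^4), Smk g (a1 * c2^2), Smk g (a2'^5), Smk g (a2' * c2^2)} ∧
    Module.finrank ℚ (SComp g 5) = 4 := by
  have h0 : 0 ≤ g := by omega
  have hv : ![Smk g (a1 * a2'^4), Smk g (a1 * c2^2), Smk g (a2'^5), Smk g (a2' * c2^2)] =
      Smk g ∘ basisMon := by
    ext i
    fin_cases i <;> simp [basisMon, mon_eq]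
  have hspan := SComp_five_eq_span h0
  have hset : Set.range (Smk g ∘ basisMon) =
      {Smk g (a1 * a2'^4), Smk g (a1 * c2^2), Smk g (a2'^5), Smk g (a2' * c2^2)} := by
    rw [← hv]
    simp only [Matrix.range_cons, Matrix.range_empty, Set.union_empty, Set.singleton_union]
  have hli : LinearIndependent ℚ (Smk g ∘ basisMon) := by
    rw [linearIndependent_iff_card_le_finrank_span, Set.finrank, ← hspan, Fintype.card_fin]
    exact four_le_finrank_SComp_five g
  refine ⟨hv ▸ hli, hset ▸ hspan, ?_⟩
  rw [hspan, finrank_span_eq_card hli, Fintype.card_fin]
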